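/- For every positive integer N, for Lebesgue almost every x ∈ [0,1), the Lyapunov exponent of T_N exists along the orbit of x and equals lim_{n→∞} (1/n) Σ_{k=0}^{n-1} ln|T_N'(T_N^k(x))| = 2Λ_N + ln N, where Λ_N = Θ(1/N)/ln(1+1/N) and Θ(x) = ∫_0^x ln(1+t)/t dt. (Here |T_N'(y)| = N/y² for y in the interior of each branch.) -/

import Mathlib

open MeasureTheory Filter Set

/-- The generalized Gauss transformation `T_N(x) = {N/x}` (and `T_N(0) = 0`). -/
noncomputable def gaussT (N : ℕ) (x : ℝ) : ℝ :=
  if x = 0 then 0 else Int.fract ((N : ℝ) / x)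

/-- The dilogarithm-type function `Θ(x) = ∫_0^x log(1+t)/t dt`. -/
noncomputable def dilogTheta (x : ℝ) : ℝ :=
  ∫ t in (0:ℝ)..x, Real.log (1 + t) / t

/-- The constant `Λ_N = Θ(1/N) / log(1 + 1/N)`. -/
noncomputable def gaussLambda (N : ℕ) : ℝ :=
  dilogTheta (1 / (N : ℝ)) / Real.log (1 + 1 / (N : ℝ))

/-- The second moment of Birkhoff sums grows like `n² m² + O(n)` under summable correlations. -/
theorem integral_birkhoffSum_sq_le {Ω : Type*} [MeasurableSpace Ω] {μ : Measure Ω}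
    [IsProbabilityMeasure μ] {T : Ω → Ω} (hT : MeasurePreserving T μ μ) {f : Ω → ℝ}
    (hf : MemLp f 2 μ) {m : ℝ} {b : ℕ → ℝ} (hb0 : ∀ n, 0 ≤ b n) (hb : Summable b)
    (hcov : ∀ n, ∫ x, f x * f (T^[n + 1] x) ∂μ ≤ m ^ 2 + b n) (n : ℕ) :
    ∫ x, birkhoffSum T f n x ^ 2 ∂μ ≤
      (n : ℝ) ^ 2 * m ^ 2 + n * (∫ x, f x ^ 2 ∂μ + 2 * ∑' k, b k) := by
  have hiter : ∀ k, MemLp (fun x => f (T^[k] x)) 2 μ := fun k =>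
    hf.comp_measurePreserving (hT.iterate k)
  have hS : ∀ n, MemLp (birkhoffSum T f n) 2 μ := fun n => by
    have := memLp_finsetSum (Finset.range n) (fun k _ => hiter k)
    exact this
  induction n with
  | zero => simp
  | succ n ih =>
    have hST : MemLp (fun x => birkhoffSum T f n (T x)) 2 μ :=
      (hS n).comp_measurePreserving hT
    have hexp : ∀ x, birkhoffSum T f (n + 1) x ^ 2 =
        f x ^ 2 + (2 * ∑ k ∈ Finset.range n, f x * f (T^[k + 1] x)) +
          birkhoffSum T f n (T x) ^ 2 := fun x => by
      rw [birkhoffSum_succ', ← Finset.mul_sum]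
      have : birkhoffSum T f n (T x) = ∑ k ∈ Finset.range n, f (T^[k + 1] x) := by
        simp [birkhoffSum, Function.iterate_succ_apply]
      rw [← this]; ring
    have hprod : ∀ k, Integrable (fun x => f x * f (T^[k + 1] x)) μ := fun k =>
      hf.integrable_mul (hiter (k + 1))
    have hsum : Integrable (fun x => 2 * ∑ k ∈ Finset.range n, f x * f (T^[k + 1] x)) μ :=
      (integrable_finsetSum _ fun k _ => hprod k).const_mul 2
    have hinv : ∫ x, birkhoffSum T f n (T x) ^ 2 ∂μ = ∫ x, birkhoffSum T f n x ^ 2 ∂μ := by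
      have h := integral_map (μ := μ) hT.measurable.aemeasurable
        (f := fun y => birkhoffSum T f n y ^ 2)
        (by rw [hT.map_eq]; exact (hS n).integrable_sq.aestronglyMeasurable)
      rw [hT.map_eq] at h
      exact h.symm
    have hcross : ∑ k ∈ Finset.range n, ∫ x, f x * f (T^[k + 1] x) ∂μ ≤
        n * m ^ 2 + ∑' k, b k := by
      calc _ ≤ ∑ k ∈ Finset.range n, (m ^ 2 + b k) := Finset.sum_le_sum fun k _ => hcov k
        _ = n * m ^ 2 + ∑ k ∈ Finset.range n, b k := by
          simp [Finset.sum_add_distrib]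
        _ ≤ _ := by gcongr; exact hb.sum_le_tsum _ fun k _ => hb0 k
    simp_rw [hexp]
    have hfst : Integrable (fun x => f x ^ 2 +
        2 * ∑ k ∈ Finset.range n, f x * f (T^[k + 1] x)) μ := hf.integrable_sq.add hsum
    rw [integral_add hfst hST.integrable_sq,
      integral_add hf.integrable_sq hsum, integral_const_mul,
      integral_finsetSum _ fun k _ => hprod k, hinv]
    push_cast
    nlinarith [sq_nonneg m]

/-- A strong law of large numbers for nonnegative square integrable observables of a measure
preserving map with summable correlations. -/
theorem ae_tendsto_birkhoffSum_div {Ω : Type*} [MeasurableSpace Ω] {μ : Measure Ω}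
    [IsProbabilityMeasure μ] {T : Ω → Ω} (hT : MeasurePreserving T μ μ) {f : Ω → ℝ}
    (hf0 : ∀ x, 0 ≤ f x) (hf : MemLp f 2 μ) {b : ℕ → ℝ} (hb0 : ∀ n, 0 ≤ b n) (hb : Summable b)
    (hcov : ∀ n, ∫ x, f x * f (T^[n + 1] x) ∂μ ≤ (∫ x, f x ∂μ) ^ 2 + b n) :
    ∀ᵐ x ∂μ, Tendsto (fun n : ℕ => birkhoffSum T f n x / n) atTop (nhds (∫ x, f x ∂μ)) := by
  set m := ∫ x, f x ∂μ with hm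
  set C := ∫ x, f x ^ 2 ∂μ + 2 * ∑' k, b k
  have hiter : ∀ k, MemLp (fun x => f (T^[k] x)) 2 μ := fun k =>
    hf.comp_measurePreserving (hT.iterate k)
  have hS : ∀ n, MemLp (birkhoffSum T f n) 2 μ := fun n =>
    memLp_finsetSum (Finset.range n) (fun k _ => hiter k)
  have hmean : ∀ n : ℕ, ∫ x, birkhoffSum T f n x ∂μ = n * m := fun n => by
    simp only [birkhoffSum]
    rw [integral_finsetSum _ fun k _ => (hiter k).integrable one_le_two]
    have : ∀ k, ∫ x, f (T^[k] x) ∂μ = m := fun k => by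
      have h := integral_map (μ := μ) (hT.iterate k).measurable.aemeasurable (f := f)
        (by rw [(hT.iterate k).map_eq]; exact hf.aestronglyMeasurable)
      rw [(hT.iterate k).map_eq] at h
      exact h.symm
    simp [this]
  have hvar : ∀ n : ℕ, ∫ x, (birkhoffSum T f n x - n * m) ^ 2 ∂μ ≤ n * C := fun n => by
    have hexp : ∀ x, (birkhoffSum T f n x - n * m) ^ 2 =
        birkhoffSum T f n x ^ 2 - 2 * (n * m) * birkhoffSum T f n x + (n * m) ^ 2 :=
      fun x => by ring
    simp_rw [hexp]
    have hi := ((hS n).integrable one_le_two).const_mul (2 * (n * m))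
    have hfst : Integrable (fun x => birkhoffSum T f n x ^ 2 -
        2 * (n * m) * birkhoffSum T f n x) μ := (hS n).integrable_sq.sub hi
    rw [integral_add hfst (integrable_const _),
      integral_sub (hS n).integrable_sq hi, integral_const_mul, hmean]
    have := integral_birkhoffSum_sq_le hT hf hb0 hb hcov n
    simp only [integral_const, probReal_univ, one_smul]
    nlinarith
  set Y : ℕ → Ω → ℝ := fun k x =>
    (birkhoffSum T f ((k + 1) ^ 2) x / ((k + 1) ^ 2 : ℕ) - m) ^ 2 with hY
  have hYeq : ∀ k x, Y k x = ((((k + 1 : ℕ) : ℝ) ^ 4)⁻¹) *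
      (birkhoffSum T f ((k + 1) ^ 2) x - ((k + 1) ^ 2 : ℕ) * m) ^ 2 := fun k x => by
    simp only [hY]
    push_cast
    field_simp
  have hSm : ∀ n, Integrable (fun x => (birkhoffSum T f n x - n * m) ^ 2) μ := fun n =>
    ((hS n).sub (memLp_const _)).integrable_sq
  have hYint : ∀ k, Integrable (Y k) μ := fun k =>
    ((hSm ((k + 1) ^ 2)).const_mul _).congr (ae_of_all _ fun x => (hYeq k x).symm)
  have hYle : ∀ k, ∫ x, Y k x ∂μ ≤ C * (1 / ((k + 1 : ℕ) : ℝ) ^ 2) := fun k => by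
    simp_rw [hYeq]
    rw [integral_const_mul]
    have h := hvar ((k + 1) ^ 2)
    calc _ ≤ (((k + 1 : ℕ) : ℝ) ^ 4)⁻¹ * (((k + 1) ^ 2 : ℕ) * C) := by gcongr
      _ = _ := by push_cast; field_simp
  have hsummable : Summable fun k : ℕ => C * (1 / ((k + 1 : ℕ) : ℝ) ^ 2) :=
    ((summable_nat_add_iff 1).2 (Real.summable_one_div_nat_pow.2 one_lt_two)).mul_left C
  have hfin : ∫⁻ x, ∑' k, ENNReal.ofReal (Y k x) ∂μ ≠ ⊤ := by
    rw [lintegral_tsum fun k => (hYint k).aestronglyMeasurable.aemeasurable.ennreal_ofReal]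
    refine ne_top_of_le_ne_top hsummable.tsum_ofReal_ne_top (ENNReal.tsum_le_tsum fun k => ?_)
    rw [← ofReal_integral_eq_lintegral_ofReal (hYint k) (ae_of_all _ fun x => sq_nonneg _)]
    exact ENNReal.ofReal_le_ofReal (hYle k)
  filter_upwards [ae_lt_top' (AEMeasurable.tsum fun k =>
    (hYint k).aestronglyMeasurable.aemeasurable.ennreal_ofReal) hfin] with x hx
  have hlim : Tendsto (fun k : ℕ => birkhoffSum T f ((k + 1) ^ 2) x / ((k + 1) ^ 2 : ℕ)) atTop
      (nhds m) := by
    have h0 := ENNReal.tendsto_atTop_zero_of_tsum_ne_top hx.ne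
    have h1 : Tendsto (fun k => Y k x) atTop (nhds 0) := by
      have := (ENNReal.tendsto_toReal ENNReal.zero_ne_top).comp h0
      refine this.congr fun k => ?_
      simp [hY, sq_nonneg]
    have h2 := h1.sqrt
    simp only [hY, Real.sqrt_sq_eq_abs, Real.sqrt_zero] at h2
    simpa using (tendsto_zero_iff_abs_tendsto_zero _).2 h2 |>.add_const m
  refine tendsto_div_of_monotone_of_exists_subseq_tendsto_div _ m ?_ fun a ha =>
    ⟨fun k => (k + 1) ^ 2, ?_, ?_, hlim⟩
  · refine monotone_nat_of_le_succ fun n => ?_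
    rw [birkhoffSum_succ]
    linarith [hf0 (T^[n] x)]
  · have h : Tendsto (fun n : ℕ => (1 + 1 / ((n : ℝ) + 1)) ^ 2) atTop (nhds 1) := by
      simpa using (tendsto_one_div_add_atTop_nhds_zero_nat (𝕜 := ℝ)).const_add 1 |>.pow 2
    filter_upwards [h.eventually_lt_const ha] with n hn
    have hpos : (0 : ℝ) < (n : ℝ) + 1 := by positivity
    push_cast
    calc ((n : ℝ) + 1 + 1) ^ 2 = (1 + 1 / ((n : ℝ) + 1)) ^ 2 * ((n : ℝ) + 1) ^ 2 := by
          field_simp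
      _ ≤ _ := by gcongr
  · exact (tendsto_pow_atTop two_ne_zero).comp (tendsto_add_atTop_nat 1)

/-- The `j`-th inverse branch of `gaussT N`. -/
noncomputable def gaussBranch (N j : ℕ) (x : ℝ) : ℝ := N / (N + j + x)

/-- The probability of the `j`-th branch under the transfer operator, as a difference of tails. -/
noncomputable def gaussWeight (N j : ℕ) (x : ℝ) : ℝ :=
  (N + x) / (N + j + x) - (N + x) / (N + j + 1 + x)

/-- The transfer operator of `gaussT N` relative to its invariant measure. -/
noncomputable def gaussTransfer (N : ℕ) (f : ℝ → ENNReal) (x : ℝ) : ENNReal :=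
  ∑' j : ℕ, ENNReal.ofReal (gaussWeight N j x) * f (gaussBranch N j x)

/-- The density of the invariant measure of `gaussT N` on `(0, 1]`. -/
noncomputable def gaussDensity (N : ℕ) (x : ℝ) : ℝ :=
  1 / (Real.log (1 + 1 / (N : ℝ)) * (N + x))

/-- The invariant measure of `gaussT N`. -/
noncomputable def gaussMeasure (N : ℕ) : Measure ℝ :=
  (volume.restrict (Ioc 0 1)).withDensity fun x => ENNReal.ofReal (gaussDensity N x)

theorem measurable_gaussT (N : ℕ) : Measurable (gaussT N) :=
  Measurable.ite (measurableSet_singleton 0) measurable_const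
    (measurable_fract.comp (measurable_const.div measurable_id))

theorem measurable_gaussBranch (N j : ℕ) : Measurable (gaussBranch N j) := by
  unfold gaussBranch; fun_prop

theorem measurable_gaussWeight (N j : ℕ) : Measurable (gaussWeight N j) := by
  unfold gaussWeight; fun_prop

theorem measurable_gaussDensity (N : ℕ) : Measurable (gaussDensity N) := by
  unfold gaussDensity; fun_prop

theorem measurable_gaussTransfer (N : ℕ) {f : ℝ → ENNReal} (hf : Measurable f) :
    Measurable (gaussTransfer N f) :=
  Measurable.tsum fun j => (measurable_gaussWeight N j).ennreal_ofReal.mul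
    (hf.comp (measurable_gaussBranch N j))

theorem gaussBranch_mem {N : ℕ} (hN : 0 < N) (j : ℕ) {x : ℝ} (hx : x ∈ Icc (0 : ℝ) 1) :
    gaussBranch N j x ∈ Ioc (0 : ℝ) 1 := by
  have hN' : (0 : ℝ) < N := by exact_mod_cast hN
  have := hx.1
  refine ⟨by unfold gaussBranch; positivity, ?_⟩
  unfold gaussBranch
  rw [div_le_one (by positivity)]
  linarith [(Nat.cast_nonneg j : (0 : ℝ) ≤ j)]

theorem gaussT_gaussBranch {N : ℕ} (hN : 0 < N) (j : ℕ) {x : ℝ} (hx : x ∈ Ico (0 : ℝ) 1) :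
    gaussT N (gaussBranch N j x) = x := by
  have hN' : (N : ℝ) ≠ 0 := by exact_mod_cast hN.ne'
  have h := (gaussBranch_mem hN j ⟨hx.1, hx.2.le⟩).1.ne'
  have h2 : (N : ℝ) / gaussBranch N j x = ((N + j : ℕ) : ℝ) + x := by
    unfold gaussBranch; rw [div_div_cancel₀ hN']; push_cast; ring
  rw [gaussT, if_neg h, h2, Int.fract_natCast_add, Int.fract_eq_self.2 hx]

theorem iUnion_gaussBranch_image {N : ℕ} (hN : 0 < N) :
    ⋃ j, gaussBranch N j '' Ico 0 1 = Ioc (0 : ℝ) 1 := by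
  have hN' : (0 : ℝ) < N := by exact_mod_cast hN
  ext y
  simp only [mem_iUnion, mem_image]
  constructor
  · rintro ⟨j, x, hx, rfl⟩
    exact gaussBranch_mem hN j ⟨hx.1, hx.2.le⟩
  · intro hy
    have h1 : (N : ℝ) ≤ N / y := by
      rw [le_div_iff₀ hy.1]; nlinarith [hy.2]
    have h2 : N ≤ ⌊(N : ℝ) / y⌋₊ := Nat.le_floor h1
    have h3 := Nat.floor_le (hN'.le.trans h1)
    have h4 := Nat.lt_floor_add_one ((N : ℝ) / y)
    refine ⟨⌊(N : ℝ) / y⌋₊ - N, N / y - ⌊(N : ℝ) / y⌋₊, ⟨by linarith, by linarith⟩, ?_⟩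
    rw [gaussBranch, Nat.cast_sub h2]
    have : (N : ℝ) + (⌊(N : ℝ) / y⌋₊ - N) + (N / y - ⌊(N : ℝ) / y⌋₊) = N / y := by ring
    rw [this, div_div_cancel₀ hN'.ne']

theorem disjoint_gaussBranch_image {N : ℕ} (hN : 0 < N) :
    Pairwise (Function.onFun Disjoint fun j => gaussBranch N j '' Ico (0 : ℝ) 1) := by
  have hN' : (N : ℝ) ≠ 0 := by exact_mod_cast hN.ne'
  intro i j hij
  rw [Function.onFun, Set.disjoint_left]
  rintro _ ⟨x, hx, rfl⟩ ⟨y, hy, h⟩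
  have hxy : y = x := by
    have := congrArg (gaussT N) h
    rwa [gaussT_gaussBranch hN j hy, gaussT_gaussBranch hN i hx] at this
  subst hxy
  unfold gaussBranch at h
  rw [div_eq_div_iff_comm, div_left_inj' hN'] at h
  apply hij
  have : (j : ℝ) = i := by linarith
  exact_mod_cast this.symm

theorem setLIntegral_gaussBranch_image {N : ℕ} (hN : 0 < N) (j : ℕ) (g : ℝ → ENNReal) :
    ∫⁻ y in gaussBranch N j '' Ico 0 1, g y =
      ∫⁻ x in Ico (0 : ℝ) 1, ENNReal.ofReal (N / (N + j + x) ^ 2) * g (gaussBranch N j x) := by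
  have hN' : (0 : ℝ) < N := by exact_mod_cast hN
  have hder : ∀ x ∈ Ico (0 : ℝ) 1,
      HasDerivWithinAt (gaussBranch N j) (-(N / (N + j + x) ^ 2)) (Ico 0 1) x := fun x hx => by
    have := hx.1
    have hne : (N : ℝ) + j + x ≠ 0 := by positivity
    have := ((hasDerivAt_id x).const_add ((N : ℝ) + j)).fun_inv hne |>.const_mul (N : ℝ)
    refine HasDerivAt.hasDerivWithinAt (this.congr_deriv ?_)
    simp only [id]; ring
  rw [lintegral_image_eq_lintegral_abs_deriv_mul measurableSet_Ico hder]
  · simp_rw [abs_neg]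
    refine setLIntegral_congr_fun measurableSet_Ico fun x _ => ?_
    rw [abs_of_nonneg (by positivity)]
  · intro x hx y hy h
    have := congrArg (gaussT N) h
    rwa [gaussT_gaussBranch hN j hx, gaussT_gaussBranch hN j hy] at this

theorem log_one_add_one_div_pos {N : ℕ} (hN : 0 < N) : 0 < Real.log (1 + 1 / (N : ℝ)) := by
  have hN' : (0 : ℝ) < N := by exact_mod_cast hN
  exact Real.log_pos (by simp [hN'])

theorem gaussDensity_branch {N : ℕ} (hN : 0 < N) (j : ℕ) {x : ℝ} (hx : 0 ≤ x) :
    N / (N + j + x) ^ 2 * gaussDensity N (gaussBranch N j x) =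
      gaussDensity N x * gaussWeight N j x := by
  have hN' : (0 : ℝ) < N := by exact_mod_cast hN
  have := (log_one_add_one_div_pos hN).ne'
  have h1 : (N : ℝ) + j + x ≠ 0 := by positivity
  have h2 : (N : ℝ) + j + 1 + x ≠ 0 := by positivity
  have h3 : (N : ℝ) + x ≠ 0 := by positivity
  have h4 : (N : ℝ) + N / (N + j + x) = N * (N + j + 1 + x) / (N + j + x) := by
    field_simp; ring
  unfold gaussDensity gaussBranch gaussWeight
  rw [h4]
  generalize Real.log (1 + 1 / (N : ℝ)) = c at *
  field_simp
  ring

theorem lintegral_gaussMeasure (N : ℕ) {g : ℝ → ENNReal} (hg : Measurable g) :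
    ∫⁻ x, g x ∂gaussMeasure N = ∫⁻ x in Ioc 0 1, ENNReal.ofReal (gaussDensity N x) * g x :=
  lintegral_withDensity_eq_lintegral_mul _ (measurable_gaussDensity N).ennreal_ofReal hg

theorem gaussDensity_nonneg {N : ℕ} (hN : 0 < N) {x : ℝ} (hx : 0 ≤ x) : 0 ≤ gaussDensity N x := by
  have := (log_one_add_one_div_pos hN)
  unfold gaussDensity
  positivity

/-- Duality between the transfer operator and composition with `gaussT N`. -/
theorem lintegral_mul_comp_gaussT {N : ℕ} (hN : 0 < N) {f g : ℝ → ENNReal}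
    (hf : Measurable f) (hg : Measurable g) :
    ∫⁻ x, f x * g (gaussT N x) ∂gaussMeasure N =
      ∫⁻ x, gaussTransfer N f x * g x ∂gaussMeasure N := by
  have hgT : Measurable fun x => g (gaussT N x) := hg.comp (measurable_gaussT N)
  rw [lintegral_gaussMeasure N (g := fun x => f x * g (gaussT N x)) (hf.mul hgT),
    lintegral_gaussMeasure N (g := fun x => gaussTransfer N f x * g x)
      ((measurable_gaussTransfer N hf).mul hg),
    ← iUnion_gaussBranch_image hN, lintegral_iUnion ?_ (disjoint_gaussBranch_image hN),
    iUnion_gaussBranch_image hN, ← Measure.restrict_congr_set Ico_ae_eq_Ioc]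
  · calc _ = ∑' j, ∫⁻ x in Ico (0 : ℝ) 1, ENNReal.ofReal (gaussDensity N x) *
          (ENNReal.ofReal (gaussWeight N j x) * f (gaussBranch N j x) * g x) := by
          refine tsum_congr fun j => ?_
          rw [setLIntegral_gaussBranch_image hN]
          refine setLIntegral_congr_fun measurableSet_Ico fun x hx => ?_
          rw [gaussT_gaussBranch hN j hx]
          simp only [← mul_assoc]
          have := hx.1
          rw [← ENNReal.ofReal_mul (by positivity), gaussDensity_branch hN j hx.1,
            ENNReal.ofReal_mul (gaussDensity_nonneg hN hx.1)]
      _ = _ := by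
          rw [← lintegral_tsum]
          · refine lintegral_congr fun x => ?_
            rw [ENNReal.tsum_mul_left, ENNReal.tsum_mul_right, gaussTransfer]
          · exact fun j => ((measurable_gaussDensity N).ennreal_ofReal.mul
              (((measurable_gaussWeight N j).ennreal_ofReal.mul
                (hf.comp (measurable_gaussBranch N j))).mul hg)).aemeasurable
  · intro j
    refine measurableSet_Ico.image_of_measurable_injOn (measurable_gaussBranch N j) ?_
    intro x hx y hy h
    have := congrArg (gaussT N) h
    rwa [gaussT_gaussBranch hN j hx, gaussT_gaussBranch hN j hy] at this

/-- The transfer operator as an average over a uniform variable `u`, which turns stochastic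
domination between the branch distributions into a pointwise inequality. -/
theorem tsum_gaussWeight_mul {N : ℕ} (hN : 0 < N) {x : ℝ} (hx : 0 ≤ x) (g : ℕ → ENNReal) :
    ∑' j : ℕ, ENNReal.ofReal (gaussWeight N j x) * g j =
      ∫⁻ u in Ioc (0 : ℝ) 1, g ⌊(N + x) * (1 / u - 1)⌋₊ := by
  have hN' : (0 : ℝ) < N := by exact_mod_cast hN
  have hmeas : Measurable fun u : ℝ => ⌊(N + x) * (1 / u - 1)⌋₊ :=
    Nat.measurable_floor.comp (by fun_prop)
  rw [← lintegral_map (measurable_from_top (f := g)) hmeas, lintegral_countable']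
  refine tsum_congr fun j => ?_
  rw [Measure.map_apply hmeas (measurableSet_singleton j),
    Measure.restrict_apply (hmeas (measurableSet_singleton j)), mul_comm]
  congr 1
  have : (fun u : ℝ => ⌊(N + x) * (1 / u - 1)⌋₊) ⁻¹' {j} ∩ Ioc (0 : ℝ) 1 =
      Ioc ((N + x) / (N + j + 1 + x)) ((N + x) / (N + j + x)) := by
    ext u
    simp only [mem_inter_iff, mem_preimage, mem_singleton_iff, mem_Ioc]
    have key : ∀ u : ℝ, 0 < u → u ≤ 1 → (⌊(N + x) * (1 / u - 1)⌋₊ = j ↔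
        (N + x) / (N + j + 1 + x) < u ∧ u ≤ (N + x) / (N + j + x)) := fun u h0 h1 => by
      have hnn : 0 ≤ (N + x) * (1 / u - 1) :=
        mul_nonneg (by positivity) (by rw [sub_nonneg, one_le_div h0]; exact h1)
      have e : (N + x) * (1 / u - 1) = (N + x) / u - (N + x) := by ring
      rw [Nat.floor_eq_iff hnn, e, div_lt_iff₀ (by positivity), le_div_iff₀ (by positivity),
        le_sub_iff_add_le, le_div_iff₀ h0, sub_lt_iff_lt_add, div_lt_iff₀ h0, and_comm]
      constructor <;> rintro ⟨h1, h2⟩ <;> constructor <;> linarith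
    constructor
    · rintro ⟨h, h0, h1⟩
      exact (key u h0 h1).1 h
    · intro h
      have h0 : 0 < u := lt_of_le_of_lt (by positivity) h.1
      have h1 : u ≤ 1 := h.2.trans (by
        rw [div_le_one (by positivity)]; linarith [(Nat.cast_nonneg j : (0 : ℝ) ≤ j)])
      exact ⟨(key u h0 h1).2 h, h0, h1⟩
  rw [this, Real.volume_Ioc, gaussWeight]

theorem tsum_gaussWeight {N : ℕ} (hN : 0 < N) {x : ℝ} (hx : 0 ≤ x) :
    ∑' j : ℕ, ENNReal.ofReal (gaussWeight N j x) = 1 := by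
  simpa using tsum_gaussWeight_mul hN hx fun _ => 1

theorem gaussBranch_floor_le {N : ℕ} (hN : 0 < N) {x y u : ℝ} (hx : 0 ≤ x) (hxy : x ≤ y)
    (hu : u ∈ Ioc (0 : ℝ) 1) :
    gaussBranch N ⌊(N + y) * (1 / u - 1)⌋₊ y ≤ gaussBranch N ⌊(N + x) * (1 / u - 1)⌋₊ x := by
  have hu1 : 0 ≤ 1 / u - 1 := by rw [sub_nonneg, one_le_div hu.1]; exact hu.2
  have hN' : (0 : ℝ) < N := by exact_mod_cast hN
  unfold gaussBranch
  gcongr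

theorem antitoneOn_gaussTransfer {N : ℕ} (hN : 0 < N) {f : ℝ → ENNReal}
    (hf : MonotoneOn f (Ioc 0 1)) : AntitoneOn (gaussTransfer N f) (Icc 0 1) := by
  intro x hx y hy hxy
  simp only [gaussTransfer]
  rw [tsum_gaussWeight_mul hN hx.1 fun j => f (gaussBranch N j x),
    tsum_gaussWeight_mul hN hy.1 fun j => f (gaussBranch N j y)]
  exact setLIntegral_mono' measurableSet_Ioc fun u hu => hf (gaussBranch_mem hN _ hy)
    (gaussBranch_mem hN _ hx) (gaussBranch_floor_le hN hx.1 hxy hu)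

theorem monotoneOn_gaussTransfer {N : ℕ} (hN : 0 < N) {f : ℝ → ENNReal}
    (hf : AntitoneOn f (Ioc 0 1)) : MonotoneOn (gaussTransfer N f) (Icc 0 1) := by
  intro x hx y hy hxy
  simp only [gaussTransfer]
  rw [tsum_gaussWeight_mul hN hx.1 fun j => f (gaussBranch N j x),
    tsum_gaussWeight_mul hN hy.1 fun j => f (gaussBranch N j y)]
  exact setLIntegral_mono' measurableSet_Ioc fun u hu => hf (gaussBranch_mem hN _ hy)
    (gaussBranch_mem hN _ hx) (gaussBranch_floor_le hN hx.1 hxy hu)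

/-- Iterated form of the duality. -/
theorem lintegral_mul_comp_iterate_gaussT {N : ℕ} (hN : 0 < N) {f g : ℝ → ENNReal}
    (hf : Measurable f) (hg : Measurable g) (n : ℕ) :
    ∫⁻ x, f x * g ((gaussT N)^[n] x) ∂gaussMeasure N =
      ∫⁻ x, (gaussTransfer N)^[n] f x * g x ∂gaussMeasure N := by
  induction n generalizing f with
  | zero => rfl
  | succ n ih =>
    simp only [Function.iterate_succ_apply]
    rw [← ih (measurable_gaussTransfer N hf),
      ← lintegral_mul_comp_gaussT hN hf (g := fun x => g ((gaussT N)^[n] x))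
        (hg.comp ((measurable_gaussT N).iterate n))]

theorem measurePreserving_gaussT {N : ℕ} (hN : 0 < N) :
    MeasurePreserving (gaussT N) (gaussMeasure N) (gaussMeasure N) := by
  refine ⟨measurable_gaussT N, Measure.ext fun s hs => ?_⟩
  have hone : ∀ x ∈ Ioc (0 : ℝ) 1, gaussTransfer N (fun _ => 1) x = 1 := fun x hx => by
    simpa [gaussTransfer] using tsum_gaussWeight hN hx.1.le
  have h := lintegral_mul_comp_gaussT hN (f := fun _ => 1) (g := s.indicator 1)
    measurable_const (measurable_one.indicator hs)
  have h2 : ∫⁻ x, gaussTransfer N (fun _ => 1) x * s.indicator 1 x ∂gaussMeasure N =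
      ∫⁻ x, s.indicator 1 x ∂gaussMeasure N := by
    refine lintegral_congr_ae ((withDensity_absolutelyContinuous _ _).ae_le ?_)
    filter_upwards [ae_restrict_mem measurableSet_Ioc] with x hx
    rw [hone x hx, one_mul]
  simp only [one_mul] at h
  rw [h2, lintegral_indicator_one hs] at h
  rw [Measure.map_apply (measurable_gaussT N) hs, ← h,
    ← lintegral_indicator_one (measurable_gaussT N hs)]
  rfl

theorem isProbabilityMeasure_gaussMeasure {N : ℕ} (hN : 0 < N) :
    IsProbabilityMeasure (gaussMeasure N) := by
  have hN' : (0 : ℝ) < N := by exact_mod_cast hN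
  have hlog := log_one_add_one_div_pos hN
  constructor
  have h := lintegral_gaussMeasure N (g := fun _ => 1) measurable_const
  simp only [lintegral_const, one_mul, mul_one] at h
  have hcont : ContinuousOn (gaussDensity N) (Icc 0 1) := by
    unfold gaussDensity
    refine continuousOn_const.div (by fun_prop) fun x hx => ?_
    have := hx.1
    positivity
  have hint : IntervalIntegrable (gaussDensity N) volume 0 1 :=
    (hcont.mono (by rw [uIcc_of_le zero_le_one])).intervalIntegrable
  have hF : ∫ x in (0 : ℝ)..1, gaussDensity N x = 1 := by
    rw [intervalIntegral.integral_eq_sub_of_hasDerivAt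
      (f := fun x => Real.log (N + x) / Real.log (1 + 1 / (N : ℝ))) ?_ hint]
    · rw [← sub_div, add_zero, ← Real.log_div (by positivity) hN'.ne', add_div, div_self hN'.ne',
        div_self hlog.ne']
    · intro x hx
      rw [uIcc_of_le zero_le_one] at hx
      have hx0 := hx.1
      have hne : (N : ℝ) + x ≠ 0 := by positivity
      refine (((hasDerivAt_id x).const_add (N : ℝ)).log hne |>.div_const _).congr_deriv ?_
      simp only [gaussDensity, id, div_div]
      rw [mul_comm]
  rw [h, ← ofReal_integral_eq_lintegral_ofReal, ← intervalIntegral.integral_of_le zero_le_one, hF,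
    ENNReal.ofReal_one]
  · exact (intervalIntegrable_iff_integrableOn_Ioc_of_le zero_le_one).1 hint
  · filter_upwards [ae_restrict_mem measurableSet_Ioc] with x hx
    exact gaussDensity_nonneg hN hx.1.le

theorem gaussTransfer_zero {N : ℕ} (hN : 0 < N) (f : ℝ → ENNReal) :
    gaussTransfer N f 0 = ENNReal.ofReal (1 / (N + 1)) * f 1 + ∑' j : ℕ,
      ENNReal.ofReal (N / ((N + 1 + j) * (N + 2 + j))) * f (gaussBranch N j 1) := by
  have hN' : (0 : ℝ) < N := by exact_mod_cast hN
  rw [gaussTransfer, tsum_eq_zero_add' ENNReal.summable]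
  congr 1
  · congr 2
    · unfold gaussWeight; push_cast; field_simp; ring
    · unfold gaussBranch; push_cast; field_simp; ring
  · refine tsum_congr fun j => ?_
    congr 2
    · unfold gaussWeight; push_cast; field_simp; ring
    · unfold gaussBranch; push_cast; ring

theorem gaussWeight_one (N j : ℕ) :
    gaussWeight N j 1 = (N + 1) * (1 / ((N + 1 + j) * (N + 2 + j))) := by
  unfold gaussWeight
  have h1 : (N : ℝ) + j + 1 ≠ 0 := by positivity
  have h2 : (N : ℝ) + j + 1 + 1 ≠ 0 := by positivity
  have h3 : (N : ℝ) + 1 + j ≠ 0 := by positivity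
  have h4 : (N : ℝ) + 2 + j ≠ 0 := by positivity
  field_simp; ring

theorem gaussTransfer_zero_eq {N : ℕ} (hN : 0 < N) (f : ℝ → ENNReal) :
    gaussTransfer N f 0 = ENNReal.ofReal (1 / (N + 1)) * f 1 +
      ENNReal.ofReal (N / (N + 1)) * gaussTransfer N f 1 := by
  rw [gaussTransfer_zero hN, gaussTransfer, ← ENNReal.tsum_mul_left]
  congr 1
  refine tsum_congr fun j => ?_
  rw [← mul_assoc, ← ENNReal.ofReal_mul (by positivity), gaussWeight_one]
  congr 2
  field_simp

/-- A function oscillating by at most `δ` is sent to endpoint values differing by at most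
`δ / (N + 1)`. -/
theorem gaussTransfer_endpoints {N : ℕ} (hN : 0 < N) {f : ℝ → ENNReal} {δ : ENNReal}
    (hf : ∀ u ∈ Ioc (0 : ℝ) 1, ∀ v ∈ Ioc (0 : ℝ) 1, f u ≤ f v + δ) :
    gaussTransfer N f 0 ≤ gaussTransfer N f 1 + ENNReal.ofReal (1 / (N + 1)) * δ ∧
      gaussTransfer N f 1 ≤ gaussTransfer N f 0 + ENNReal.ofReal (1 / (N + 1)) * δ := by
  have h1 : (1 : ℝ) ∈ Ioc (0 : ℝ) 1 := ⟨one_pos, le_rfl⟩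
  have hmem := fun j => gaussBranch_mem hN j (x := 1) ⟨zero_le_one, le_rfl⟩
  have havg : ∀ c : ENNReal, ∑' j : ℕ, ENNReal.ofReal (gaussWeight N j 1) * c = c := fun c => by
    rw [ENNReal.tsum_mul_right, tsum_gaussWeight hN zero_le_one, one_mul]
  have hlow : f 1 ≤ gaussTransfer N f 1 + δ := by
    calc f 1 = ∑' j : ℕ, ENNReal.ofReal (gaussWeight N j 1) * f 1 := (havg _).symm
      _ ≤ ∑' j : ℕ, (ENNReal.ofReal (gaussWeight N j 1) * f (gaussBranch N j 1) +
          ENNReal.ofReal (gaussWeight N j 1) * δ) := ENNReal.tsum_le_tsum fun j => by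
            rw [← mul_add]; gcongr; exact hf _ h1 _ (hmem j)
      _ = _ := by rw [ENNReal.tsum_add, havg, gaussTransfer]
  have hupp : gaussTransfer N f 1 ≤ f 1 + δ := by
    calc gaussTransfer N f 1 ≤ ∑' j : ℕ, ENNReal.ofReal (gaussWeight N j 1) * (f 1 + δ) :=
          ENNReal.tsum_le_tsum fun j => by gcongr; exact hf _ (hmem j) _ h1
      _ = _ := havg _
  have hsplit : ENNReal.ofReal (1 / ((N : ℝ) + 1)) + ENNReal.ofReal (N / ((N : ℝ) + 1)) = 1 := by
    rw [← ENNReal.ofReal_add (by positivity) (by positivity), ← add_div, add_comm,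
      div_self (by positivity), ENNReal.ofReal_one]
  rw [gaussTransfer_zero_eq hN]
  set p := ENNReal.ofReal (1 / ((N : ℝ) + 1))
  set q := ENNReal.ofReal (N / ((N : ℝ) + 1))
  set A := gaussTransfer N f 1
  constructor
  · calc p * f 1 + q * A ≤ p * (A + δ) + q * A := by gcongr
      _ = (p + q) * A + p * δ := by ring
      _ = A + p * δ := by rw [hsplit, one_mul]
  · calc A = p * A + q * A := by rw [← add_mul, hsplit, one_mul]
      _ ≤ p * (f 1 + δ) + q * A := by gcongr
      _ = _ := by ring

theorem gaussTransfer_oscillation {N : ℕ} (hN : 0 < N) {f : ℝ → ENNReal} {δ : ENNReal}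
    (hmono : MonotoneOn f (Ioc 0 1) ∨ AntitoneOn f (Ioc 0 1))
    (hf : ∀ u ∈ Ioc (0 : ℝ) 1, ∀ v ∈ Ioc (0 : ℝ) 1, f u ≤ f v + δ) :
    ∀ u ∈ Icc (0 : ℝ) 1, ∀ v ∈ Icc (0 : ℝ) 1,
      gaussTransfer N f u ≤ gaussTransfer N f v + δ / 2 := by
  intro u hu v hv
  have h0 : (0 : ℝ) ∈ Icc (0 : ℝ) 1 := ⟨le_rfl, zero_le_one⟩
  have h1 : (1 : ℝ) ∈ Icc (0 : ℝ) 1 := ⟨zero_le_one, le_rfl⟩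
  have hp : ENNReal.ofReal (1 / ((N : ℝ) + 1)) * δ ≤ δ / 2 := by
    rw [ENNReal.div_eq_inv_mul]
    refine mul_le_mul' ?_ le_rfl
    have hN1 : (1 : ℝ) ≤ N := by exact_mod_cast hN
    rw [show (2 : ENNReal)⁻¹ = ENNReal.ofReal (2⁻¹) by
      rw [ENNReal.ofReal_inv_of_pos two_pos, ENNReal.ofReal_ofNat], one_div]
    exact ENNReal.ofReal_le_ofReal (inv_anti₀ two_pos (by linarith))
  obtain ⟨hE1, hE2⟩ := gaussTransfer_endpoints hN hf
  rcases hmono with h | h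
  · have ha := antitoneOn_gaussTransfer hN h
    exact (ha h0 hu hu.1).trans (hE1.trans (add_le_add (ha hv h1 hv.2) hp))
  · have ha := monotoneOn_gaussTransfer hN h
    exact (ha hu h1 hu.2).trans (hE2.trans (add_le_add (ha h0 hv hv.1) hp))

theorem iterate_gaussTransfer_oscillation {N : ℕ} (hN : 0 < N) {f : ℝ → ENNReal} {δ : ENNReal}
    (hmono : MonotoneOn f (Ioc 0 1) ∨ AntitoneOn f (Ioc 0 1))
    (hf : ∀ u ∈ Ioc (0 : ℝ) 1, ∀ v ∈ Ioc (0 : ℝ) 1, f u ≤ f v + δ) (n : ℕ) :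
    ∀ u ∈ Ioc (0 : ℝ) 1, ∀ v ∈ Ioc (0 : ℝ) 1,
      (gaussTransfer N)^[n] f u ≤ (gaussTransfer N)^[n] f v + δ / 2 ^ n := by
  induction n generalizing f δ with
  | zero => simpa using hf
  | succ n ih =>
    have hmono' : MonotoneOn (gaussTransfer N f) (Ioc 0 1) ∨
        AntitoneOn (gaussTransfer N f) (Ioc 0 1) :=
      hmono.symm.imp (fun h => (monotoneOn_gaussTransfer hN h).mono Ioc_subset_Icc_self)
        (fun h => (antitoneOn_gaussTransfer hN h).mono Ioc_subset_Icc_self)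
    have h := ih hmono' fun u hu v hv => gaussTransfer_oscillation hN hmono hf u
      (Ioc_subset_Icc_self hu) v (Ioc_subset_Icc_self hv)
    have e : δ / 2 / 2 ^ n = δ / 2 ^ (n + 1) := by
      rw [div_eq_mul_inv, div_eq_mul_inv, div_eq_mul_inv, mul_assoc, pow_succ, mul_comm (2 ^ n),
        ENNReal.mul_inv (by simp) (by simp)]
    rw [← e]
    exact h

theorem ae_gaussMeasure_mem (N : ℕ) : ∀ᵐ x ∂gaussMeasure N, x ∈ Ioc (0 : ℝ) 1 :=
  (withDensity_absolutelyContinuous _ _).ae_le (ae_restrict_mem measurableSet_Ioc)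

theorem lintegral_gaussTransfer {N : ℕ} (hN : 0 < N) {f : ℝ → ENNReal} (hf : Measurable f)
    (n : ℕ) :
    ∫⁻ x, (gaussTransfer N)^[n] f x ∂gaussMeasure N = ∫⁻ x, f x ∂gaussMeasure N := by
  simpa using (lintegral_mul_comp_iterate_gaussT hN hf (g := fun _ => 1) measurable_const n).symm

/-- Exponential decay of correlations for an antitone observable. -/
theorem lintegral_mul_comp_iterate_le {N : ℕ} (hN : 0 < N) {f : ℝ → ENNReal} (hfm : Measurable f)
    (hf : AntitoneOn f (Ioc 0 1)) (n : ℕ) :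
    ∫⁻ x, f x * f ((gaussT N)^[n + 1] x) ∂gaussMeasure N ≤
      (∫⁻ x, f x ∂gaussMeasure N + gaussTransfer N f 1 / 2 ^ n) * ∫⁻ x, f x ∂gaussMeasure N := by
  have := isProbabilityMeasure_gaussMeasure hN
  have h1 : (1 : ℝ) ∈ Icc (0 : ℝ) 1 := ⟨zero_le_one, le_rfl⟩
  have hmono := monotoneOn_gaussTransfer hN hf
  have hosc := iterate_gaussTransfer_oscillation hN (f := gaussTransfer N f)
    (δ := gaussTransfer N f 1) (.inl (hmono.mono Ioc_subset_Icc_self))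
    (fun u hu v _ => (hmono (Ioc_subset_Icc_self hu) h1 hu.2).trans le_add_self) n
  rw [lintegral_mul_comp_iterate_gaussT hN hfm hfm, ← lintegral_const_mul _ hfm]
  refine lintegral_mono_ae ?_
  filter_upwards [ae_gaussMeasure_mem N] with x hx
  refine mul_le_mul' ?_ le_rfl
  rw [Function.iterate_succ_apply]
  calc (gaussTransfer N)^[n] (gaussTransfer N f) x
      = ∫⁻ _, (gaussTransfer N)^[n] (gaussTransfer N f) x ∂gaussMeasure N := by simp
    _ ≤ ∫⁻ y, ((gaussTransfer N)^[n] (gaussTransfer N f) y + gaussTransfer N f 1 / 2 ^ n)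
          ∂gaussMeasure N := by
        refine lintegral_mono_ae ?_
        filter_upwards [ae_gaussMeasure_mem N] with y hy
        exact hosc x hx y hy
    _ = _ := by
        rw [lintegral_add_right _ measurable_const, lintegral_const, measure_univ, mul_one,
          ← Function.iterate_succ_apply, lintegral_gaussTransfer hN hfm]

theorem gaussTransfer_one_ne_top {N : ℕ} (hN : 0 < N) {f : ℝ → ENNReal} (hfm : Measurable f)
    (hf : AntitoneOn f (Ioc 0 1)) (hint : ∫⁻ x, f x ∂gaussMeasure N ≠ ⊤) :
    gaussTransfer N f 1 ≠ ⊤ := by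
  have := isProbabilityMeasure_gaussMeasure hN
  have hN' : (0 : ℝ) < N := by exact_mod_cast hN
  have hmono := monotoneOn_gaussTransfer hN hf
  have h0 : gaussTransfer N f 0 ≠ ⊤ := by
    refine ne_top_of_le_ne_top hint ?_
    rw [← lintegral_gaussTransfer hN hfm 1]
    calc gaussTransfer N f 0 = ∫⁻ _, gaussTransfer N f 0 ∂gaussMeasure N := by simp
      _ ≤ _ := by
        refine lintegral_mono_ae ?_
        filter_upwards [ae_gaussMeasure_mem N] with y hy
        exact hmono ⟨le_rfl, zero_le_one⟩ (Ioc_subset_Icc_self hy) hy.1.le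
  intro h
  rw [gaussTransfer_zero_eq hN, h, ENNReal.mul_top] at h0
  · exact h0 (by simp)
  · simp only [ne_eq, ENNReal.ofReal_eq_zero, not_le]
    positivity

theorem integrable_gaussMeasure {N : ℕ} (hN : 0 < N) {f : ℝ → ℝ}
    (hf : IntegrableOn f (Ioc 0 1)) : Integrable f (gaussMeasure N) := by
  have hN' : (0 : ℝ) < N := by exact_mod_cast hN
  have hlog := log_one_add_one_div_pos hN
  have hle : gaussMeasure N ≤ ENNReal.ofReal (gaussDensity N 0) • volume.restrict (Ioc 0 1) := by
    rw [gaussMeasure, ← withDensity_const]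
    refine withDensity_mono ?_
    filter_upwards [ae_restrict_mem measurableSet_Ioc] with x hx
    refine ENNReal.ofReal_le_ofReal ?_
    have := hx.1
    unfold gaussDensity
    gcongr
  exact (hf.smul_measure ENNReal.ofReal_ne_top).mono_measure hle

theorem integrableOn_log_sq : IntegrableOn (fun x : ℝ => |Real.log x| ^ 2) (Ioc 0 1) := by
  have hr : IntegrableOn (fun x : ℝ => 16 * x ^ (-(1 / 2) : ℝ)) (Ioc 0 1) :=
    ((intervalIntegrable_iff_integrableOn_Ioc_of_le zero_le_one).1
      (intervalIntegral.intervalIntegrable_rpow' (by norm_num))).const_mul 16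
  refine Integrable.mono' hr (by fun_prop) ?_
  filter_upwards [ae_restrict_mem measurableSet_Ioc] with x hx
  have h := Real.abs_log_mul_self_rpow_lt x (1 / 4) hx.1 hx.2 (by norm_num)
  have hp := Real.rpow_pos_of_pos hx.1 (1 / 4)
  rw [abs_mul, abs_of_pos hp] at h
  have h2 : (x ^ (1 / 4 : ℝ)) ^ 2 * x ^ (-(1 / 2) : ℝ) = 1 := by
    rw [← Real.rpow_natCast, ← Real.rpow_mul hx.1.le, ← Real.rpow_add hx.1]
    norm_num
  have h3 : (|Real.log x| * x ^ (1 / 4 : ℝ)) ^ 2 ≤ 16 := by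
    have : 0 ≤ |Real.log x| * x ^ (1 / 4 : ℝ) := by positivity
    nlinarith
  rw [Real.norm_of_nonneg (by positivity)]
  calc |Real.log x| ^ 2 = (|Real.log x| * x ^ (1 / 4 : ℝ)) ^ 2 * x ^ (-(1 / 2) : ℝ) := by
        rw [mul_pow, mul_assoc, h2, mul_one]
    _ ≤ _ := by
      have := Real.rpow_nonneg hx.1.le (-(1 / 2))
      gcongr

theorem memLp_abs_log {N : ℕ} (hN : 0 < N) :
    MemLp (fun x : ℝ => |Real.log x|) 2 (gaussMeasure N) := by
  rw [memLp_two_iff_integrable_sq (by fun_prop)]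
  exact integrable_gaussMeasure hN integrableOn_log_sq

theorem continuousOn_log_mul_log_one_add_div {N : ℕ} (hN : 0 < N) :
    ContinuousOn (fun x : ℝ => Real.log x * Real.log (1 + x / N)) (Icc 0 1) := by
  have hN' : (0 : ℝ) < N := by exact_mod_cast hN
  intro x hx
  have hc : 0 ≤ x → ContinuousAt (fun x : ℝ => Real.log (1 + x / N)) x := fun h => by
    have : (1 : ℝ) + x / N ≠ 0 := by positivity
    exact ContinuousAt.log (by fun_prop) this
  rcases hx.1.eq_or_lt with rfl | hpos
  · have hlim : Tendsto (fun x : ℝ => |x * Real.log x| / N) (nhdsWithin 0 (Icc 0 1)) (nhds 0) := by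
      have := ((Real.continuous_mul_log.abs.div_const (N : ℝ)).tendsto 0).mono_left
        (nhdsWithin_le_nhds (s := Icc (0 : ℝ) 1))
      simpa using this
    have h0 : Real.log (0 : ℝ) * Real.log (1 + 0 / N) = 0 := by simp
    unfold ContinuousWithinAt
    simp only [h0]
    refine squeeze_zero_norm' ?_ hlim
    filter_upwards [self_mem_nhdsWithin] with y hy
    have hy0 : 0 ≤ y / N := div_nonneg hy.1 hN'.le
    have h1 : 0 ≤ Real.log (1 + y / N) := Real.log_nonneg (by linarith)
    have h2 : Real.log (1 + y / N) ≤ y / N := by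
      linarith [Real.log_le_sub_one_of_pos (show 0 < 1 + y / N by linarith)]
    rw [Real.norm_eq_abs, abs_mul, abs_of_nonneg h1, abs_mul, abs_of_nonneg hy.1]
    calc _ ≤ |Real.log y| * (y / N) := by gcongr
      _ = _ := by ring
  · exact ((Real.continuousAt_log hpos.ne').mul (hc hx.1)).continuousWithinAt

theorem integral_log_mul_div {N : ℕ} (hN : 0 < N) :
    ∫ x in (0 : ℝ)..1, -Real.log x / (N + x) = dilogTheta (1 / N) := by
  have hN' : (0 : ℝ) < N := by exact_mod_cast hN
  have hsub : dilogTheta (1 / N) = ∫ x in (0 : ℝ)..1, Real.log (1 + x / N) / x := by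
    have h := intervalIntegral.integral_comp_div (a := 0) (b := 1)
      (fun t : ℝ => Real.log (1 + t) / t) hN'.ne'
    rw [zero_div] at h
    rw [dilogTheta, eq_comm, ← inv_smul_smul₀ hN'.ne' (∫ t in (0 : ℝ)..1 / N, _), ← h,
      ← intervalIntegral.integral_smul]
    refine intervalIntegral.integral_congr fun x _ => ?_
    simp only [smul_eq_mul]
    rw [div_div_eq_mul_div]
    field_simp
  have hi1 : IntervalIntegrable (fun x : ℝ => Real.log (1 + x / N) / x) volume 0 1 := by
    rw [intervalIntegrable_iff_integrableOn_Ioc_of_le zero_le_one]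
    refine Integrable.mono' (integrable_const (1 / (N : ℝ)))
      (Measurable.aestronglyMeasurable (by fun_prop)) ?_
    filter_upwards [ae_restrict_mem measurableSet_Ioc] with x hx
    have hx0 := hx.1
    have hy0 : 0 < x / N := by positivity
    have h1 : 0 ≤ Real.log (1 + x / N) := Real.log_nonneg (by linarith)
    have h2 : Real.log (1 + x / N) ≤ x / N := by
      linarith [Real.log_le_sub_one_of_pos (show 0 < 1 + x / N by linarith)]
    rw [Real.norm_of_nonneg (by positivity), div_le_iff₀ hx0]
    linarith [show 1 / (N : ℝ) * x = x / N by ring]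
  have hi2 : IntervalIntegrable (fun x : ℝ => Real.log x * (1 / (N + x))) volume 0 1 := by
    refine intervalIntegral.intervalIntegrable_log'.mul_continuousOn ?_
    refine continuousOn_const.div (by fun_prop) fun x hx => ?_
    rw [uIcc_of_le zero_le_one] at hx
    have := hx.1
    positivity
  have hFTC := intervalIntegral.integral_eq_sub_of_hasDerivAt_of_le zero_le_one
    (continuousOn_log_mul_log_one_add_div hN)
    (f' := fun x => Real.log (1 + x / N) / x + Real.log x * (1 / (N + x)))
    (fun x hx => by
      have hx0 := hx.1
      have hne : (1 : ℝ) + x / N ≠ 0 := by positivity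
      refine ((Real.hasDerivAt_log hx0.ne').mul
        ((((hasDerivAt_id x).div_const (N : ℝ)).const_add 1).log hne)).congr_deriv ?_
      simp only [id]
      field_simp) (hi1.add hi2)
  rw [intervalIntegral.integral_add hi1 hi2, ← hsub] at hFTC
  simp only [Real.log_one, zero_mul, zero_div, add_zero, mul_zero, sub_zero] at hFTC
  have : ∀ x : ℝ, -Real.log x / (N + x) = -(Real.log x * (1 / (N + x))) := fun x => by ring
  simp_rw [this]
  rw [intervalIntegral.integral_neg]
  linarith

theorem integral_abs_log_gaussMeasure {N : ℕ} (hN : 0 < N) :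
    ∫ x, |Real.log x| ∂gaussMeasure N = gaussLambda N := by
  rw [gaussLambda, ← integral_log_mul_div hN, intervalIntegral.integral_of_le zero_le_one,
    ← integral_div, gaussMeasure]
  rw [show (fun x => ENNReal.ofReal (gaussDensity N x)) =
    fun x => (((gaussDensity N x).toNNReal : NNReal) : ENNReal) from rfl,
    integral_withDensity_eq_integral_smul (measurable_gaussDensity N).real_toNNReal]
  refine setIntegral_congr_fun measurableSet_Ioc fun x hx => ?_
  simp only [NNReal.smul_def, smul_eq_mul]
  rw [Real.coe_toNNReal _ (gaussDensity_nonneg hN hx.1.le),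
    abs_of_nonpos (Real.log_nonpos hx.1.le hx.2), gaussDensity, mul_comm (Real.log _), ← div_div]
  ring

theorem integral_abs_log_mul_comp_le {N : ℕ} (hN : 0 < N) : ∃ K : ℝ, 0 ≤ K ∧ ∀ n,
    ∫ x, |Real.log x| * |Real.log ((gaussT N)^[n + 1] x)| ∂gaussMeasure N ≤
      (∫ x, |Real.log x| ∂gaussMeasure N) ^ 2 + K * (1 / 2) ^ n := by
  have := isProbabilityMeasure_gaussMeasure hN
  set m := ∫ x, |Real.log x| ∂gaussMeasure N with hm
  have hm0 : 0 ≤ m := integral_nonneg fun x => abs_nonneg _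
  set f : ℝ → ENNReal := fun x => ENNReal.ofReal |Real.log x|
  have hfm : Measurable f := by fun_prop
  have hlin : ∫⁻ x, f x ∂gaussMeasure N = ENNReal.ofReal m :=
    (ofReal_integral_eq_lintegral_ofReal ((memLp_abs_log hN).integrable one_le_two)
      (ae_of_all _ fun x => abs_nonneg _)).symm
  have hf : AntitoneOn f (Ioc 0 1) := fun x hx y hy hxy => ENNReal.ofReal_le_ofReal (by
    rw [abs_of_nonpos (Real.log_nonpos hx.1.le hx.2),
      abs_of_nonpos (Real.log_nonpos hy.1.le hy.2)]
    exact neg_le_neg (Real.log_le_log hx.1 hxy))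
  have htop := gaussTransfer_one_ne_top hN hfm hf (by rw [hlin]; exact ENNReal.ofReal_ne_top)
  refine ⟨(gaussTransfer N f 1).toReal * m, by positivity, fun n => ?_⟩
  have hle := lintegral_mul_comp_iterate_le hN hfm hf n
  have hT := (measurable_gaussT N).iterate (n + 1)
  rw [integral_eq_lintegral_of_nonneg_ae (ae_of_all _ fun x => by positivity)
    (Measurable.aestronglyMeasurable (by fun_prop))]
  refine ENNReal.toReal_le_of_le_ofReal (by positivity) ?_
  simp_rw [ENNReal.ofReal_mul (abs_nonneg _)]
  refine hle.trans_eq ?_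
  rw [hlin, ← ENNReal.ofReal_toReal htop, ENNReal.toReal_ofReal ENNReal.toReal_nonneg,
    show (2 : ENNReal) ^ n = ENNReal.ofReal (2 ^ n) by
      rw [ENNReal.ofReal_pow two_pos.le, ENNReal.ofReal_ofNat],
    ← ENNReal.ofReal_div_of_pos (by positivity), ← ENNReal.ofReal_add hm0 (by positivity),
    ← ENNReal.ofReal_mul (by positivity)]
  congr 1
  rw [div_pow, one_pow]
  ring

theorem ae_iterate_gaussT_mem {N : ℕ} (hN : 0 < N) :
    ∀ᵐ x ∂gaussMeasure N, ∀ n, (gaussT N)^[n] x ∈ Ioc (0 : ℝ) 1 :=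
  ae_all_iff.2 fun n =>
    ((measurePreserving_gaussT hN).iterate n).quasiMeasurePreserving.ae
      (p := fun y => y ∈ Ioc (0 : ℝ) 1) (ae_gaussMeasure_mem N)

theorem restrict_absolutelyContinuous_gaussMeasure {N : ℕ} (hN : 0 < N) :
    volume.restrict (Ico (0 : ℝ) 1) ≪ gaussMeasure N := by
  rw [Measure.restrict_congr_set Ico_ae_eq_Ioc]
  refine withDensity_absolutelyContinuous'
    (measurable_gaussDensity N).ennreal_ofReal.aemeasurable ?_
  filter_upwards [ae_restrict_mem measurableSet_Ioc] with x hx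
  have := log_one_add_one_div_pos hN
  have hx0 := hx.1
  simp only [ne_eq, ENNReal.ofReal_eq_zero, not_le, gaussDensity]
  positivity

/-- For Lebesgue almost every `x ∈ [0,1)`, the Lyapunov exponent of `T_N` along the
orbit of `x` exists and equals `2Λ_N + log N`; here `|T_N'(y)| = N / y²`. -/
theorem gaussT_lyapunov (N : ℕ) (hN : 0 < N) :
    ∀ᵐ x ∂(volume.restrict (Set.Ico (0:ℝ) 1)),
      Tendsto (fun n : ℕ =>
          (1 / (n : ℝ)) *
            ∑ k ∈ Finset.range n, Real.log ((N : ℝ) / ((gaussT N)^[k] x) ^ 2))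
        atTop (nhds (2 * gaussLambda N + Real.log N)) := by
  have := isProbabilityMeasure_gaussMeasure hN
  have hN' : (N : ℝ) ≠ 0 := by exact_mod_cast hN.ne'
  obtain ⟨K, hK, hcov⟩ := integral_abs_log_mul_comp_le hN
  refine (restrict_absolutelyContinuous_gaussMeasure hN).ae_le ?_
  filter_upwards [ae_tendsto_birkhoffSum_div (measurePreserving_gaussT hN)
    (fun x => abs_nonneg (Real.log x)) (memLp_abs_log hN) (fun n => by positivity)
    (summable_geometric_two.mul_left K) hcov, ae_iterate_gaussT_mem hN] with x hx hmem
  rw [integral_abs_log_gaussMeasure hN] at hx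
  refine ((hx.const_mul 2).add_const (Real.log N)).congr' ?_
  filter_upwards [eventually_ne_atTop 0] with n hn
  have hn' : (n : ℝ) ≠ 0 := by exact_mod_cast hn
  have hterm : ∀ k, Real.log ((N : ℝ) / ((gaussT N)^[k] x) ^ 2) =
      Real.log N + 2 * |Real.log ((gaussT N)^[k] x)| := fun k => by
    have h := hmem k
    rw [Real.log_div hN' (pow_ne_zero 2 h.1.ne'), Real.log_pow,
      abs_of_nonpos (Real.log_nonpos h.1.le h.2)]
    push_cast; ring
  simp_rw [hterm]
  rw [Finset.sum_add_distrib, ← Finset.mul_sum, birkhoffSum]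
  simp only [Finset.sum_const, Finset.card_range, nsmul_eq_mul]
  field_simp
  ring
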